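/- Let M be a 3-connected matroid with two disjoint triads S = {s1,s2,s3} and T = {t1,t2,t3}. If {s1,s2,t1,t2} is a circuit of M and s3 is not contained in any triangle of M, then M/s3 is 3-connected. -/

import Mathlib

open Set

namespace PaperDefs

variable {α : Type*}

/-- The rank of a set `X` in a matroid `M`, as an extended natural number:
the supremum of the cardinalities of independent subsets of `X`. -/
noncomputable def eRk (M : Matroid α) (X : Set α) : ℕ∞ :=
  ⨆ I ∈ {I | M.Indep I ∧ I ⊆ X}, I.encard

/-- Deletion of a set of elements from a matroid. -/
def del (M : Matroid α) (D : Set α) : Matroid α := M.restrict (M.E \ D)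

/-- Contraction of a set of elements in a matroid. -/
def con (M : Matroid α) (C : Set α) : Matroid α := (del M✶ C)✶

/-- A circuit: a minimal dependent set. -/
def Circuit (M : Matroid α) (C : Set α) : Prop :=
  M.Dep C ∧ ∀ D, D ⊂ C → M.Indep D

/-- A `k`-separation of `M`: a partition `(X, M.E \ X)` with connectivity
`λ(X) = r(X) + r(E−X) − r(M)` at most `k − 1`, and both sides of size at least `k`. -/
def kSeparation (M : Matroid α) (X : Set α) (k : ℕ) : Prop :=
  X ⊆ M.E ∧ eRk M X + eRk M (M.E \ X) ≤ eRk M M.E + ((k - 1 : ℕ) : ℕ∞) ∧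
    (k : ℕ∞) ≤ X.encard ∧ (k : ℕ∞) ≤ (M.E \ X).encard

/-- `M` is `n`-connected if it has no `k`-separations for `0 < k < n`. -/
def NConnected (M : Matroid α) (n : ℕ) : Prop :=
  ∀ k : ℕ, 0 < k → k < n → ∀ X : Set α, ¬ kSeparation M X k

/-- `X` is 3-separating in `M`: `λ_M(X) ≤ 2`. -/
def ThreeSeparating (M : Matroid α) (X : Set α) : Prop :=
  eRk M X + eRk M (M.E \ X) ≤ eRk M M.E + 2

/-- `X` is exactly 3-separating in `M`: `λ_M(X) = 2`. -/
def ExactlyThreeSeparating (M : Matroid α) (X : Set α) : Prop :=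
  eRk M X + eRk M (M.E \ X) = eRk M M.E + 2

/-- `N` is a simplification of `M`: `N` is obtained from `M` by deleting a set of
elements, `N` has no loops or parallel pairs (no circuits of size at most two), and
every element of `M` is in the closure of the ground set of `N`. -/
def IsSimplificationOf (N M : Matroid α) : Prop :=
  (∃ D ⊆ M.E, N = del M D) ∧ (∀ C, Circuit N C → 3 ≤ C.encard) ∧
    M.closure N.E = M.E

/-- `N` is a cosimplification of `M`: `N✶` is a simplification of `M✶`. -/
def IsCosimplificationOf (N M : Matroid α) : Prop :=
  IsSimplificationOf N✶ M✶

/-- `S` is a series class of `M`: a maximal nonempty set any two distinct elements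
of which form a series pair (a two-element cocircuit). -/
def IsSeriesClass (M : Matroid α) (S : Set α) : Prop :=
  S.Nonempty ∧ S ⊆ M.E ∧ (∀ a ∈ S, ∀ b ∈ S, a ≠ b → Circuit M✶ {a, b}) ∧
    (∀ a ∈ S, ∀ f, Circuit M✶ {a, f} → a ≠ f → f ∈ S)

/-- The full closure of `X` in `M`: the intersection of all sets containing `X ∩ M.E`
that are closed in both `M` and `M✶`. -/
def fullClosure (M : Matroid α) (X : Set α) : Set α :=
  ⋂₀ {F | X ∩ M.E ⊆ F ∧ M.closure F = F ∧ M✶.closure F = F}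

end PaperDefs

open PaperDefs

namespace PaperDefs

open scoped Matroid

variable {α : Type*} {M : Matroid α} {e x : α} {X Y C K : Set α}

lemma eRk_eq_matroid_eRk (M : Matroid α) (X : Set α) : eRk M X = M.eRk X := by
  refine le_antisymm (iSup₂_le fun I hI ↦ hI.1.encard_le_eRk_of_subset hI.2) ?_
  obtain ⟨I, hIX, hI, hcard⟩ := Matroid.le_eRk_iff.1 (le_refl (M.eRk X))
  rw [← hcard]
  exact le_iSup₂_of_le I ⟨hI, hIX⟩ le_rfl

lemma encard_pair_ne_three (a b : α) : ({a, b} : Set α).encard ≠ 3 := by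
  intro h
  have hle := encard_insert_le ({b} : Set α) a
  rw [h, encard_singleton] at hle
  exact absurd hle (by decide)

lemma Circuit.isCircuit (h : Circuit M C) : M.IsCircuit C :=
  Matroid.isCircuit_iff_forall_ssubset.2 ⟨h.1, fun _ hD ↦ h.2 _ hD⟩

lemma circuit_of_isCircuit (h : M.IsCircuit C) : Circuit M C :=
  ⟨h.dep, fun _ hD ↦ h.ssubset_indep hD⟩

lemma con_eq_contract (M : Matroid α) (C : Set α) : con M C = M ／ C := rfl

/-- A cocircuit blocks membership in the closure of a set that it avoids. -/
lemma notMem_closure_of_isCocircuit (hK : M.IsCocircuit K) (hx : x ∈ K) (hd : Disjoint K X) :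
    x ∉ M.closure X := by
  intro hcl
  obtain ⟨C, hCX, hC, hxC⟩ := Matroid.exists_isCircuit_of_mem_closure hcl (hd.notMem_of_mem_left hx)
  refine hC.inter_isCocircuit_ne_singleton hK (e := x) ?_
  ext y
  refine ⟨fun hy ↦ ?_, by rintro rfl; exact ⟨hxC, hx⟩⟩
  exact (hCX hy.1).resolve_right (hd.notMem_of_mem_left hy.2)

lemma eRk_contractElem_add_one (he : M.IsNonloop e) (hX : X ⊆ M.E \ {e}) :
    (M ／ {e}).eRk X + 1 = M.eRk (insert e X) := by
  obtain ⟨J, hJ⟩ := (M ／ {e}).exists_isBasis X hX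
  have heJ : e ∉ J := fun h ↦ (hX (hJ.subset h)).2 rfl
  have hb := he.indep.union_isBasis_union_of_contract_isBasis hJ
  rw [union_singleton, union_singleton] at hb
  rw [hJ.eRk_eq_encard, hb.eRk_eq_encard, encard_insert_of_notMem heJ]

lemma NConnected.eRank_add_lt {n k : ℕ} (h : NConnected M n) (hk : 0 < k) (hkn : k < n)
    (hdj : Disjoint X Y) (hE : X ∪ Y = M.E) (hX : k ≤ X.encard) (hY : k ≤ Y.encard) :
    M.eRank + ((k - 1 : ℕ) : ℕ∞) < M.eRk X + M.eRk Y := by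
  have hYE : M.E \ X = Y := by rw [← hE, union_sdiff_cancel_left hdj.inter_eq.subset]
  by_contra! hcon
  refine h k hk hkn X ⟨hE ▸ subset_union_left, ?_, hX, hYE ▸ hY⟩
  simpa only [eRk_eq_matroid_eRk, hYE, M.eRk_ground] using hcon

lemma NConnected.three_le_encard (h : NConnected M 3) (hE : 4 ≤ M.E.encard) (hC : M.IsCircuit C) :
    3 ≤ C.encard := by
  by_contra! hlt
  obtain ⟨k, hk⟩ := ENat.ne_top_iff_exists.1 hlt.ne_top
  have hk3 : k < 3 := by rw [← hk] at hlt; exact_mod_cast hlt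
  have hk0 : 0 < k := by
    have := hC.nonempty.encard_pos
    rw [← hk] at this
    exact_mod_cast this
  have hrk := hC.eRk_add_one_eq
  have hsum := encard_sdiff_add_encard_of_subset hC.subset_ground
  have hrest : (k : ℕ∞) ≤ (M.E \ C).encard := by
    rw [← hsum, ← hk] at hE
    generalize (M.E \ C).encard = d at *
    induction d using ENat.recTopCoe with
    | top => simp
    | coe d => norm_cast at *; omega
  have hlt' := h.eRank_add_lt hk0 hk3 disjoint_sdiff_right (union_sdiff_cancel hC.subset_ground)
    hk.le hrest
  have hC' : M.eRk C ≤ ((k - 1 : ℕ) : ℕ∞) := by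
    rw [← hk] at hrk
    generalize M.eRk C = d at *
    induction d using ENat.recTopCoe with
    | top => simp at hrk
    | coe d => norm_cast at *; omega
  refine hlt'.not_ge ?_
  rw [add_comm]
  exact add_le_add (M.eRk_le_eRank _) hC'

/-- `(X, Y)` is a partition of `M.E \ {e}` corresponding to a 2-separation of `M ／ {e}`,
phrased in terms of ranks in `M`. -/
structure ContractSep (M : Matroid α) (e : α) (X Y : Set α) : Prop where
  notMem_left : e ∉ X
  notMem_right : e ∉ Y
  disjoint : Disjoint X Y
  ground_eq : insert e (X ∪ Y) = M.E
  eRk_le : M.eRk (insert e X) + M.eRk (insert e Y) ≤ M.eRank + 2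
  two_le_left : 2 ≤ X.encard
  two_le_right : 2 ≤ Y.encard

namespace ContractSep

lemma symm (h : ContractSep M e X Y) : ContractSep M e Y X where
  notMem_left := h.notMem_right
  notMem_right := h.notMem_left
  disjoint := h.disjoint.symm
  ground_eq := by rw [union_comm, h.ground_eq]
  eRk_le := by rw [add_comm]; exact h.eRk_le
  two_le_left := h.two_le_right
  two_le_right := h.two_le_left

lemma mem_closure_right (h : ContractSep M e X Y) (h3 : NConnected M 3) : e ∈ M.closure Y := by
  by_contra hcl
  have heE : e ∈ M.E := h.ground_eq ▸ mem_insert _ _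
  have hlt := h3.eRank_add_lt (k := 2) (X := insert e X) (Y := Y) (by simp) (by simp)
    (disjoint_insert_left.2 ⟨h.notMem_right, h.disjoint⟩) (by rw [insert_union, h.ground_eq])
    (h.two_le_left.trans (encard_le_encard (subset_insert _ _))) h.two_le_right
  have hle := h.eRk_le
  rw [Matroid.eRk_insert_eq_add_one ⟨heE, hcl⟩, ← add_assoc, ← one_add_one_eq_two,
    ← add_assoc, ENat.add_le_add_iff_right (by simp)] at hle
  exact hlt.not_ge (by simpa using hle)

lemma three_le_right (h : ContractSep M e X Y) (h3 : NConnected M 3) (hE : 4 ≤ M.E.encard)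
    (htri : ¬ ∃ C : Set α, Circuit M C ∧ C.encard = 3 ∧ e ∈ C) : 3 ≤ Y.encard := by
  by_contra! hlt
  obtain ⟨C, hCY, hC, heC⟩ :=
    Matroid.exists_isCircuit_of_mem_closure (h.mem_closure_right h3) h.notMem_right
  refine htri ⟨C, circuit_of_isCircuit hC, (h3.three_le_encard hE hC).antisymm' ?_, heC⟩
  refine (encard_le_encard hCY).trans ((encard_insert_le Y e).trans ?_)
  exact Order.add_one_le_of_lt hlt

lemma not_disjoint_right (h : ContractSep M e X Y) (h3 : NConnected M 3) (hK : M.IsCocircuit K)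
    (heK : e ∈ K) : ¬ Disjoint K Y :=
  fun hd ↦ notMem_closure_of_isCocircuit hK heK hd (h.mem_closure_right h3)

/-- Moving an element of `Y` to `X` without increasing the sum of the ranks. -/
lemma move (h : ContractSep M e X Y) (hx : x ∈ Y) (hY : 3 ≤ Y.encard)
    (hle : M.eRk (insert e (insert x X)) + M.eRk (insert e (Y \ {x})) ≤ M.eRank + 2) :
    ContractSep M e (insert x X) (Y \ {x}) where
  notMem_left := by
    rintro (rfl | he)
    · exact h.notMem_right hx
    · exact h.notMem_left he
  notMem_right := fun he ↦ h.notMem_right he.1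
  disjoint := disjoint_insert_left.2 ⟨by simp, h.disjoint.mono_right sdiff_subset⟩
  ground_eq := by rw [← h.ground_eq]; grind
  eRk_le := hle
  two_le_left := h.two_le_left.trans (encard_le_encard (subset_insert _ _))
  two_le_right := by
    rw [← encard_sdiff_singleton_add_one hx, ← two_add_one_eq_three] at hY
    exact (ENat.add_le_add_iff_right (by simp)).1 hY

lemma move_of_mem_closure (h : ContractSep M e X Y) (hx : x ∈ Y) (hY : 3 ≤ Y.encard)
    (hcl : x ∈ M.closure X) : ContractSep M e (insert x X) (Y \ {x}) := by
  refine h.move hx hY (le_trans (add_le_add (le_of_eq ?_) (M.eRk_mono ?_)) h.eRk_le)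
  · rw [insert_comm, ← Matroid.eRk_closure_eq, Matroid.closure_insert_eq_of_mem_closure,
      Matroid.eRk_closure_eq]
    exact M.closure_subset_closure (subset_insert _ _) hcl
  · exact insert_subset_insert sdiff_subset

lemma move_of_isCocircuit (h : ContractSep M e X Y) (hx : x ∈ Y) (hY : 3 ≤ Y.encard)
    (hK : M.IsCocircuit K) (hxK : x ∈ K) (hKX : K ⊆ insert x X) :
    ContractSep M e (insert x X) (Y \ {x}) := by
  refine h.move hx hY (le_trans ?_ h.eRk_le)
  have hd : Disjoint K (insert e (Y \ {x})) := by
    rw [disjoint_left]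
    rintro y hyK (rfl | ⟨hyY, hyx⟩)
    · rcases hKX hyK with rfl | hyX
      · exact h.notMem_right hx
      · exact h.notMem_left hyX
    · exact h.disjoint.notMem_of_mem_right hyY ((hKX hyK).resolve_left hyx)
  have hrk := Matroid.eRk_insert_eq_add_one
    ⟨hK.subset_ground hxK, notMem_closure_of_isCocircuit hK hxK hd⟩
  rw [insert_comm, insert_sdiff_singleton, insert_eq_of_mem hx] at hrk
  rw [hrk, insert_comm, add_comm (M.eRk (insert e (Y \ {x}))), ← add_assoc]
  gcongr
  exact M.eRk_insert_le_add_one x (insert e X)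

/-- If `{a, b, e}` is a triad and `{a, b, c, d}` is a circuit, then `a`, `c`, `d` do not
lie on the same side. -/
lemma not_same_side_of_isCircuit {a b c d : α} (h : ContractSep M e X Y) (h3 : NConnected M 3)
    (hE : 4 ≤ M.E.encard) (htri : ¬ ∃ C : Set α, Circuit M C ∧ C.encard = 3 ∧ e ∈ C)
    (hK : M.IsCocircuit {a, b, e}) (hbe : b ≠ e) (hC : M.IsCircuit {a, b, c, d})
    (ha : a ∈ X) (hc : c ∈ X) (hd : d ∈ X) : False := by
  have hbX : b ∉ X := fun hb ↦ by
    refine h.not_disjoint_right h3 hK (by simp) ?_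
    rw [disjoint_insert_left, disjoint_insert_left, disjoint_singleton_left]
    exact ⟨h.disjoint.notMem_of_mem_left ha, h.disjoint.notMem_of_mem_left hb, h.notMem_right⟩
  have hbY : b ∈ Y := by
    have hb : b ∈ insert e (X ∪ Y) := h.ground_eq ▸ hK.subset_ground (by simp)
    exact (hb.resolve_left hbe).resolve_left hbX
  have hcl : b ∈ M.closure X :=
    (Matroid.mem_closure_iff_exists_isCircuit hbX).2 ⟨_, by grind, hC, by simp⟩
  have h' := h.move_of_mem_closure hbY (h.three_le_right h3 hE htri) hcl
  refine h'.not_disjoint_right h3 hK (by simp) ?_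
  rw [disjoint_insert_left, disjoint_insert_left, disjoint_singleton_left]
  exact ⟨h'.disjoint.notMem_of_mem_left (mem_insert_of_mem _ ha), by simp, h'.notMem_right⟩

/-- If moreover `{c, d, f}` is a triad, then `a`, `c`, `f` do not lie on the same side. -/
lemma not_same_side_of_isCocircuit {a b c d f : α} (h : ContractSep M e X Y) (h3 : NConnected M 3)
    (hE : 4 ≤ M.E.encard) (htri : ¬ ∃ C : Set α, Circuit M C ∧ C.encard = 3 ∧ e ∈ C)
    (hK : M.IsCocircuit {a, b, e}) (hbe : b ≠ e) (hC : M.IsCircuit {a, b, c, d})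
    (hL : M.IsCocircuit {c, d, f}) (hde : d ≠ e)
    (ha : a ∈ X) (hc : c ∈ X) (hf : f ∈ X) : False := by
  by_cases hdX : d ∈ X
  · exact h.not_same_side_of_isCircuit h3 hE htri hK hbe hC ha hc hdX
  have hdY : d ∈ Y := by
    have hd : d ∈ insert e (X ∪ Y) := h.ground_eq ▸ hL.subset_ground (by simp)
    exact (hd.resolve_left hde).resolve_left hdX
  have h' := h.move_of_isCocircuit hdY (h.three_le_right h3 hE htri) hL (by simp) (by grind)
  exact h'.not_same_side_of_isCircuit h3 hE htri hK hbe hC (mem_insert_of_mem _ ha)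
    (mem_insert_of_mem _ hc) (mem_insert _ _)

end ContractSep

/-- A `k`-separation of `M ／ {e}` with `k < 3` yields a `ContractSep` of `M`. -/
lemma NConnected.exists_contractSep (h3 : NConnected M 3) (hE : 4 ≤ M.E.encard) (he : e ∈ M.E)
    (hcon : ¬ NConnected (con M {e}) 3) : ∃ X Y, ContractSep M e X Y := by
  simp only [NConnected, not_forall, not_not, con_eq_contract] at hcon
  obtain ⟨k, hk0, hk3, X, hXE, hle, hXk, hYk⟩ := hcon
  simp only [eRk_eq_matroid_eRk, Matroid.contract_ground] at hXE hle hYk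
  set Y := (M.E \ {e}) \ X with hY
  have henl : M.IsNonloop e := by
    rw [← Matroid.not_isLoop_iff]
    intro hl
    have := h3.three_le_encard hE (Matroid.singleton_isCircuit.2 hl)
    rw [encard_singleton] at this
    exact absurd this (by decide)
  have heX : e ∉ X := fun h ↦ (hXE h).2 rfl
  have heY : e ∉ Y := fun h ↦ h.1.2 rfl
  have hdj : Disjoint X Y := disjoint_sdiff_right
  have hXY : insert e (X ∪ Y) = M.E := by
    rw [union_sdiff_cancel hXE, insert_sdiff_singleton, insert_eq_of_mem he]
  have hrX := eRk_contractElem_add_one henl hXE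
  have hrY := eRk_contractElem_add_one henl (X := Y) sdiff_subset
  have hrE := eRk_contractElem_add_one henl (subset_refl (M.E \ {e}))
  rw [insert_sdiff_singleton, insert_eq_of_mem he, M.eRk_ground] at hrE
  have hle' : M.eRk (insert e X) + M.eRk (insert e Y) ≤ M.eRank + k := by
    rw [← hrX, ← hrY, ← hrE]
    calc _ = ((M ／ {e}).eRk X + (M ／ {e}).eRk Y) + 2 := by ring
      _ ≤ ((M ／ {e}).eRk (M.E \ {e}) + ((k - 1 : ℕ) : ℕ∞)) + 2 := by gcongr
      _ = (M ／ {e}).eRk (M.E \ {e}) + 1 + (((k - 1 : ℕ) : ℕ∞) + 1) := by ring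
      _ = _ := by congr 1; norm_cast; omega
  obtain rfl | rfl : k = 1 ∨ k = 2 := by omega
  · exfalso
    have key : ∀ A B : Set α, e ∉ A → e ∉ B → Disjoint A B → insert e (A ∪ B) = M.E →
        1 ≤ A.encard → 2 ≤ B.encard →
        M.eRk (insert e A) + M.eRk (insert e B) ≤ M.eRank + 1 → False := by
      intro A B heA heB hAB hABE hA hB hr
      refine (h3.eRank_add_lt (k := 2) (X := insert e A) (Y := B) (by simp) (by simp)
        (disjoint_insert_left.2 ⟨heB, hAB⟩) (by rw [insert_union, hABE]) ?_ hB).not_ge ?_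
      · rw [encard_insert_of_notMem heA, Nat.cast_two, ← one_add_one_eq_two]
        gcongr
      · refine le_trans (add_le_add le_rfl (M.eRk_mono (subset_insert _ _))) (by simpa using hr)
    rw [Nat.cast_one] at hXk hYk hle'
    by_cases hY2 : 2 ≤ Y.encard
    · exact key X Y heX heY hdj hXY hXk hY2 hle'
    · refine key Y X heY heX hdj.symm (by rwa [union_comm]) hYk ?_ (by rwa [add_comm])
      by_contra hX2
      have hX1 : X.encard ≤ 1 := Order.le_of_lt_add_one (by simpa [one_add_one_eq_two] using hX2)
      have hY1 : Y.encard ≤ 1 := Order.le_of_lt_add_one (by simpa [one_add_one_eq_two] using hY2)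
      rw [← hXY, encard_insert_of_notMem (by simp [heX, heY]), encard_union_eq hdj] at hE
      exact absurd (hE.trans (add_le_add (add_le_add hX1 hY1) le_rfl)) (by decide)
  · exact ⟨X, Y, heX, heY, hdj, hXY, hle', hXk, hYk⟩

end PaperDefs

/-- If a 3-connected matroid `M` has disjoint triads `{s1,s2,s3}` and
`{t1,t2,t3}`, `{s1,s2,t1,t2}` is a circuit, and `s3` is in no triangle of `M`,
then `M / s3` is 3-connected. -/
theorem statement_9 {α : Type*} (M : Matroid α) (s1 s2 s3 t1 t2 t3 : α)
    (h3 : NConnected M 3)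
    (hScard : ({s1, s2, s3} : Set α).encard = 3)
    (hTcard : ({t1, t2, t3} : Set α).encard = 3)
    (hdisj : Disjoint ({s1, s2, s3} : Set α) ({t1, t2, t3} : Set α))
    (hS : Circuit M✶ {s1, s2, s3}) (hT : Circuit M✶ {t1, t2, t3})
    (hC : Circuit M {s1, s2, t1, t2})
    (hnotri : ¬ ∃ C : Set α, Circuit M C ∧ C.encard = 3 ∧ s3 ∈ C) :
    NConnected (con M {s3}) 3 := by
  have hS' := hS.isCircuit
  have hT' := hT.isCircuit
  have hC' := hC.isCircuit
  have hs13 : s1 ≠ s3 := by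
    rintro rfl
    rw [insert_comm, pair_eq_singleton] at hScard
    exact encard_pair_ne_three s2 s1 hScard
  have hs23 : s2 ≠ s3 := by
    rintro rfl
    rw [pair_eq_singleton] at hScard
    exact encard_pair_ne_three s1 s2 hScard
  have hst : ∀ t ∈ ({t1, t2, t3} : Set α), t ≠ s3 := by
    rintro t ht rfl
    exact hdisj.notMem_of_mem_left (by simp) ht
  have hE : 4 ≤ M.E.encard := by
    have h6 : ({s1, s2, s3} ∪ {t1, t2, t3} : Set α).encard = 3 + 3 := by
      rw [encard_union_eq hdisj, hScard, hTcard]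
    have := encard_le_encard (union_subset hS'.subset_ground hT'.subset_ground)
    rw [h6] at this
    exact le_trans (by norm_num) this
  have hs3E : s3 ∈ M.E := hS'.subset_ground (by simp)
  by_contra hcon
  obtain ⟨X, Y, hXY⟩ := h3.exists_contractSep hE hs3E hcon
  have hmem : ∀ y ∈ M.E, y ≠ s3 → y ∈ X ∨ y ∈ Y := fun y hy hne ↦
    (hXY.ground_eq ▸ hy : y ∈ insert s3 (X ∪ Y)).resolve_left hne
  have hsplit : ∀ {A B : Set α}, ContractSep M s3 A B → s1 ∈ A → s2 ∈ A → False := by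
    intro A B hAB h1 h2
    refine hAB.not_disjoint_right h3 hS' (by simp) ?_
    rw [disjoint_insert_left, disjoint_insert_left, disjoint_singleton_left]
    exact ⟨hAB.disjoint.notMem_of_mem_left h1, hAB.disjoint.notMem_of_mem_left h2,
      hAB.notMem_right⟩
  have hS'' : M.IsCocircuit {s2, s1, s3} := by rwa [insert_comm]
  have hT'' : M.IsCocircuit {t2, t1, t3} := by rwa [insert_comm]
  have hC1 : M.IsCircuit {s2, s1, t1, t2} := by rwa [insert_comm]
  have hC2 : M.IsCircuit {s1, s2, t2, t1} := by rwa [pair_comm t2]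
  have hC3 : M.IsCircuit {s2, s1, t2, t1} := by rwa [pair_comm t2, insert_comm]
  have hmain : ∀ {A B : Set α}, ContractSep M s3 A B → s1 ∈ A ∨ s2 ∈ A →
      ¬ (t1 ∈ A ∧ t2 ∈ A) ∧ ¬ (t1 ∈ A ∧ t3 ∈ A) ∧ ¬ (t2 ∈ A ∧ t3 ∈ A) := by
    rintro A B hAB (hs | hs)
    · exact ⟨fun h ↦ hAB.not_same_side_of_isCircuit h3 hE hnotri hS' hs23 hC' hs h.1 h.2,
        fun h ↦ hAB.not_same_side_of_isCocircuit h3 hE hnotri hS' hs23 hC' hT' (hst _ (by simp)) hs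
          h.1 h.2,
        fun h ↦ hAB.not_same_side_of_isCocircuit h3 hE hnotri hS' hs23 hC2 hT'' (hst _ (by simp)) hs
          h.1 h.2⟩
    · exact ⟨fun h ↦ hAB.not_same_side_of_isCircuit h3 hE hnotri hS'' hs13 hC1 hs h.1 h.2,
        fun h ↦ hAB.not_same_side_of_isCocircuit h3 hE hnotri hS'' hs13 hC1 hT' (hst _ (by simp)) hs
          h.1 h.2,
        fun h ↦ hAB.not_same_side_of_isCocircuit h3 hE hnotri hS'' hs13 hC3 hT'' (hst _ (by simp)) hs
          h.1 h.2⟩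
  have h1 := hmem s1 (hS'.subset_ground (by simp)) hs13
  have h2 := hmem s2 (hS'.subset_ground (by simp)) hs23
  have ht1 := hmem t1 (hT'.subset_ground (by simp)) (hst _ (by simp))
  have ht2 := hmem t2 (hT'.subset_ground (by simp)) (hst _ (by simp))
  have ht3 := hmem t3 (hT'.subset_ground (by simp)) (hst _ (by simp))
  have hs : (s1 ∈ X ∨ s2 ∈ X) ∧ (s1 ∈ Y ∨ s2 ∈ Y) := by
    have hX := hsplit hXY
    have hY := hsplit hXY.symm
    tauto
  obtain ⟨hX12, hX13, hX23⟩ := hmain hXY hs.1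
  obtain ⟨hY12, hY13, hY23⟩ := hmain hXY.symm hs.2
  clear * - ht1 ht2 ht3 hX12 hX13 hX23 hY12 hY13 hY23
  tauto
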